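/- Let T be a linear automorphism of a finite-dimensional Q-vector space V with T^n = id. Then for every natural number d, Trace(T^d) = Trace(T^{gcd(d,n)}). -/

import Mathlib

theorem trace_pow_aux {L W : Type*} [Field L] [IsAlgClosed L] [CharZero L] [AddCommGroup W]
    [Module L W] [FiniteDimensional L W] (f : Module.End L W) (n : ℕ) (hn : 1 ≤ n)
    (hf : f ^ n = 1) :
    ∃ (s : Finset L) (c : L → ℕ), (∀ μ ∈ s, μ ^ n = 1) ∧
      ∀ k : ℕ, LinearMap.trace L W (f ^ k) = ∑ μ ∈ s, μ ^ k * (c μ : L) := by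
  classical
  have hss : f.IsSemisimple := by
    have hsq : Squarefree (Polynomial.X ^ n - 1 : Polynomial L) :=
      (Polynomial.X_pow_sub_one_separable_iff.mpr (by simp; omega)).squarefree
    apply Module.End.isSemisimple_of_squarefree_aeval_eq_zero hsq
    simp [hf]
  have htop : ⨆ μ, f.eigenspace μ = ⊤ := by
    have h := Module.End.iSup_maxGenEigenspace_eq_top f
    simpa only [hss.isFinitelySemisimple.maxGenEigenspace_eq_eigenspace] using h
  have hds := DirectSum.isInternal_submodule_of_iSupIndep_of_iSup_eq_top
    f.eigenspaces_iSupIndep htop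
  have hfin : {μ | f.eigenspace μ ≠ ⊥}.Finite :=
    WellFoundedGT.finite_ne_bot_of_iSupIndep f.eigenspaces_iSupIndep
  have hpow : ∀ (k : ℕ) (μ : L) (x : W), x ∈ f.eigenspace μ → (f ^ k) x = μ ^ k • x := by
    intro k μ x hx
    rw [Module.End.mem_eigenspace_iff] at hx
    induction k with
    | zero => simp
    | succ k ih => rw [pow_succ, Module.End.mul_apply, hx, map_smul, ih, smul_smul, pow_succ']
  refine ⟨hfin.toFinset, fun μ => Module.finrank L (f.eigenspace μ), ?_, ?_⟩
  · intro μ hμ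
    rw [Set.Finite.mem_toFinset] at hμ
    obtain ⟨x, hx, hx0⟩ := (Submodule.ne_bot_iff _).mp hμ
    have h := hpow n μ x hx
    rw [hf, Module.End.one_apply] at h
    have h2 : (μ ^ n - 1) • x = 0 := by rw [sub_smul, ← h, one_smul, sub_self]
    rcases smul_eq_zero.mp h2 with h3 | h3
    · exact sub_eq_zero.mp h3
    · exact absurd h3 hx0
  · intro k
    have hm : ∀ μ, Set.MapsTo (f ^ k) (f.eigenspace μ) (f.eigenspace μ) := by
      intro μ x hx
      have := hpow k μ x hx
      rw [this]
      exact Submodule.smul_mem _ _ hx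
    rw [LinearMap.trace_eq_sum_trace_restrict' hds hfin hm]
    refine Finset.sum_congr rfl fun μ _ => ?_
    have : (f ^ k).restrict (hm μ) = μ ^ k • LinearMap.id := by
      ext x
      exact hpow k μ x x.2
    rw [this, map_smul, LinearMap.trace_id, smul_eq_mul]

theorem exists_coprime_aux (n d : ℕ) (hn : 1 ≤ n) :
    ∃ u : ℕ, Nat.Coprime u n ∧ d ≡ Nat.gcd d n * u [MOD n] := by
  have : NeZero n := ⟨by omega⟩
  obtain ⟨e, he, u, hu, h⟩ := ZMod.eq_unit_mul_divisor (d : ZMod n)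
  have huc : Nat.Coprime u.val n := by
    rw [← ZMod.isUnit_iff_coprime, ZMod.natCast_zmod_val]
    exact hu
  have hmod : d ≡ u.val * e [MOD n] := by
    rw [← ZMod.natCast_eq_natCast_iff]
    simpa using h
  have hg : Nat.gcd d n = e := by
    rw [hmod.gcd_eq, Nat.Coprime.gcd_mul_left_cancel e huc, Nat.gcd_eq_left he]
  exact ⟨u.val, huc, by rw [hg, mul_comm]; exact hmod⟩

/-- If `T` is a linear automorphism of a finite-dimensional `ℚ`-vector space with
`Tⁿ = id` (`n ≥ 1`), then for every natural number `d`,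
`Trace(T^d) = Trace(T^{gcd(d,n)})`. -/
theorem trace_pow_eq_trace_pow_gcd
    (V : Type*) [AddCommGroup V] [Module ℚ V] [FiniteDimensional ℚ V]
    (T : V ≃ₗ[ℚ] V) (n : ℕ) (hn : 1 ≤ n) (hT : T ^ n = 1) (d : ℕ) :
    LinearMap.trace ℚ V ((T ^ d : V ≃ₗ[ℚ] V) : V →ₗ[ℚ] V)
      = LinearMap.trace ℚ V ((T ^ (Nat.gcd d n) : V ≃ₗ[ℚ] V) : V →ₗ[ℚ] V) := by
  have : NeZero n := ⟨by omega⟩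
  let L := AlgebraicClosure ℚ
  let t : Module.End ℚ V := (T : V →ₗ[ℚ] V)
  have ht : ∀ k : ℕ, ((T ^ k : V ≃ₗ[ℚ] V) : V →ₗ[ℚ] V) = t ^ k := by
    intro k
    exact map_pow (LinearEquiv.automorphismGroup.toLinearMapMonoidHom (R := ℚ) (M := V)) T k
  have htn : t ^ n = 1 := by rw [← ht, hT]; rfl
  obtain ⟨s, c, hs, hc⟩ := trace_pow_aux (L := L) (LinearMap.baseChange L t) n hn
    (by rw [← LinearMap.baseChange_pow, htn]; exact LinearMap.baseChange_id)
  obtain ⟨u, hu, hd⟩ := exists_coprime_aux n d hn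
  obtain ⟨ζ, hζ⟩ := HasEnoughRootsOfUnity.exists_primitiveRoot L n
  have hmin : minpoly ℚ (ζ ^ u) = minpoly ℚ ζ := by
    rw [← Polynomial.cyclotomic_eq_minpoly_rat hζ (by omega),
      ← Polynomial.cyclotomic_eq_minpoly_rat (hζ.pow_of_coprime u hu) (by omega)]
  have : Normal ℚ L := by
    have h := @IsAlgClosure.normal ℚ (AlgebraicClosure ℚ) _ _ (AlgebraicClosure.instAlgebra ℚ)
      inferInstance
    convert h
    exact Subsingleton.elim _ _
  obtain ⟨σ, hσ⟩ := (Normal.minpoly_eq_iff_mem_orbit L).mp hmin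
  replace hσ : σ ζ = ζ ^ u := hσ
  have key : ∀ k, algebraMap ℚ L (LinearMap.trace ℚ V (t ^ k)) = ∑ μ ∈ s, μ ^ k * (c μ : L) := by
    intro k
    rw [← hc, ← LinearMap.baseChange_pow, LinearMap.trace_baseChange]
  rw [ht, ht]
  apply (algebraMap ℚ L).injective
  rw [← σ.commutes (LinearMap.trace ℚ V (t ^ Nat.gcd d n)), key, key, map_sum]
  refine Finset.sum_congr rfl fun μ hμ => ?_
  obtain ⟨i, -, rfl⟩ := hζ.eq_pow_of_pow_eq_one (hs μ hμ)
  rw [map_mul, map_natCast, map_pow, map_pow, hσ]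
  congr 1
  have h1 : (ζ ^ i) ^ d = (ζ ^ i) ^ (Nat.gcd d n * u) :=
    pow_eq_pow_of_modEq hd (hs _ hμ)
  rw [h1]
  ring
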